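/- Let M be a von Neumann algebra and x ∈ M with ‖x‖ ≤ 1. Then there exist C*-extreme points x₁, x₂ of the closed unit ball of M such that x = (x₁ + x₂)/2. In particular, using the equivalence of C*-extreme and linear extreme points in von Neumann algebras, every contraction in M is the average of two extreme points of the unit ball. -/

import Mathlib

/-- `x` is a C*-extreme point of the closed unit ball of the von Neumann algebra `M`. -/
def IsCStarExtremePoint {H : Type*} [NormedAddCommGroup H] [InnerProductSpace ℂ H]
    [CompleteSpace H] (M : VonNeumannAlgebra H) (x : H →L[ℂ] H) : Prop :=
  x ∈ M ∧ ‖x‖ ≤ 1 ∧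
    ∀ (k : ℕ) (a t : Fin k → (H →L[ℂ] H)),
      (∀ i, a i ∈ M) → (∀ i, ‖a i‖ ≤ 1) → (∀ i, t i ∈ M) →
      (∀ i, ∃ s ∈ M, t i * s = 1 ∧ s * t i = 1) →
      (∑ i, star (t i) * t i) = 1 → x = ∑ i, star (t i) * a i * t i →
      ∀ i, ∃ u ∈ M, star u * u = 1 ∧ u * star u = 1 ∧ a i = star u * x * u

open Filter Topology ContinuousLinearMap
open scoped InnerProductSpace

section

variable {H : Type*} [NormedAddCommGroup H] [InnerProductSpace ℂ H] [CompleteSpace H]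

namespace VonNeumannAlgebra

theorem mem_iff_forall_commutant {M : VonNeumannAlgebra H} {y : H →L[ℂ] H} :
    y ∈ M ↔ ∀ c ∈ M.commutant, Commute c y := by
  conv_lhs => rw [← M.commutant_commutant]
  exact mem_commutant_iff

theorem commute_of_mem_commutant {M : VonNeumannAlgebra H} {c y : H →L[ℂ] H}
    (hc : c ∈ M.commutant) (hy : y ∈ M) : Commute c y :=
  mem_iff_forall_commutant.1 hy c hc

theorem sqrt_mem {M : VonNeumannAlgebra H} {y : H →L[ℂ] H} (hy : y ∈ M) :
    CFC.sqrt y ∈ M :=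
  mem_iff_forall_commutant.2 fun _ hc =>
    ((commute_of_mem_commutant hc hy).symm.cfcₙ_nnreal NNReal.sqrt).symm

theorem abs_mem {M : VonNeumannAlgebra H} {y : H →L[ℂ] H} (hy : y ∈ M) :
    CFC.abs y ∈ M :=
  sqrt_mem (mul_mem (star_mem hy) hy)

theorem smul_mem {M : VonNeumannAlgebra H} {y : H →L[ℂ] H} (r : ℂ) (hy : y ∈ M) : r • y ∈ M :=
  M.toStarSubalgebra.smul_mem hy r

/-- A von Neumann algebra is closed under pointwise limits. -/
theorem mem_of_tendsto {M : VonNeumannAlgebra H} {ι : Type*} {l : Filter ι} [l.NeBot]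
    {w : ι → H →L[ℂ] H} {W : H →L[ℂ] H} (hw : ∀ i, w i ∈ M)
    (hW : ∀ h, Tendsto (fun i => w i h) l (𝓝 (W h))) : W ∈ M := by
  refine mem_iff_forall_commutant.2 fun c hc => ContinuousLinearMap.ext fun h => ?_
  refine tendsto_nhds_unique ((c.continuous.tendsto _).comp (hW h)) ?_
  refine (hW (c h)).congr fun i => ?_
  exact (DFunLike.congr_fun (commute_of_mem_commutant hc (hw i)) h).symm

end VonNeumannAlgebra

/-- A pointwise limit of uniformly bounded operators is a bounded operator. -/
theorem exists_continuousLinearMap_of_cauchy {ι : Type*} {l : Filter ι} [l.NeBot]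
    {w : ι → H →L[ℂ] H} {C : ℝ} (hC : ∀ i h, ‖w i h‖ ≤ C * ‖h‖)
    (hw : ∀ h, Cauchy (map (fun i => w i h) l)) :
    ∃ W : H →L[ℂ] H, (∀ h, ‖W h‖ ≤ C * ‖h‖) ∧
      ∀ h, Tendsto (fun i => w i h) l (𝓝 (W h)) := by
  choose f hf using fun h => CompleteSpace.complete (hw h)
  have hf' : Tendsto (fun i h => w i h) l (𝓝 f) := tendsto_pi_nhds.2 hf
  have hb : ∀ h, ‖f h‖ ≤ C * ‖h‖ := fun h =>
    le_of_tendsto (tendsto_norm.comp (hf h)) (Eventually.of_forall fun i => hC i h)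
  refine ⟨(linearMapOfTendsto f (fun i => (w i : H →ₗ[ℂ] H)) hf').mkContinuous C hb, hb, hf⟩

theorem norm_sq_eq_re_inner_star_mul (y : H →L[ℂ] H) (h : H) :
    ‖y h‖ ^ 2 = RCLike.re ⟪h, (star y * y) h⟫_ℂ := by
  rw [mul_apply_eq_comp, ContinuousLinearMap.star_eq_adjoint, adjoint_inner_right,
    inner_self_eq_norm_sq]

theorem norm_eq_of_star_mul_self_eq {y z : H →L[ℂ] H} (hyz : star y * y = star z * z) (h : H) :
    ‖y h‖ = ‖z h‖ := by
  rw [← sq_eq_sq₀ (norm_nonneg _) (norm_nonneg _), norm_sq_eq_re_inner_star_mul, hyz,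
    ← norm_sq_eq_re_inner_star_mul]

theorem norm_abs_apply (y : H →L[ℂ] H) (h : H) : ‖CFC.abs y h‖ = ‖y h‖ := by
  refine norm_eq_of_star_mul_self_eq ?_ h
  rw [(CFC.abs_nonneg y).isSelfAdjoint.star_eq, CFC.abs_mul_abs]

theorem star_mul_self_eq_of_norm_eq {y z : H →L[ℂ] H} (hyz : ∀ h, ‖y h‖ = ‖z h‖) :
    star y * y = star z * z := by
  have key : (star y * y : H →L[ℂ] H).toLinearMap = (star z * z : H →L[ℂ] H).toLinearMap := by
    rw [← sub_eq_zero, ← inner_map_self_eq_zero]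
    intro h
    simp [ContinuousLinearMap.star_eq_adjoint, inner_sub_left, adjoint_inner_left,
      inner_self_eq_norm_sq_to_K, hyz h]
  exact ContinuousLinearMap.coe_inj.1 key

theorem star_mul_self_eq_one_of_norm_eq {y : H →L[ℂ] H} (hy : ∀ h, ‖y h‖ = ‖h‖) :
    star y * y = 1 := by
  simpa using star_mul_self_eq_of_norm_eq (y := y) (z := 1) hy

theorem norm_apply_of_star_mul_self_eq_one {y : H →L[ℂ] H} (hy : star y * y = 1) (h : H) :
    ‖y h‖ = ‖h‖ :=
  norm_eq_of_star_mul_self_eq (z := 1) (by simpa using hy) h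

theorem norm_apply_le_of_norm_le_one {H : Type*} [NormedAddCommGroup H] [InnerProductSpace ℂ H]
    {y : H →L[ℂ] H} (hy : ‖y‖ ≤ 1) (h : H) : ‖y h‖ ≤ ‖h‖ := by
  simpa using y.le_of_opNorm_le hy h

/-- A contraction fixes, under `star y * y`, all vectors whose norm it preserves. -/
theorem star_apply_apply_of_norm_eq {y : H →L[ℂ] H} (hy : ‖y‖ ≤ 1) {h : H} (hh : ‖y h‖ = ‖h‖) :
    star y (y h) = h := by
  have hn : ‖star y (y h)‖ ≤ ‖h‖ := by
    rw [← hh]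
    exact norm_apply_le_of_norm_le_one (by simpa using hy) _
  have hi : RCLike.re ⟪star y (y h), h⟫_ℂ = ‖h‖ ^ 2 := by
    rw [ContinuousLinearMap.star_eq_adjoint, adjoint_inner_left, inner_self_eq_norm_sq, hh]
  have := norm_sub_sq (𝕜 := ℂ) (star y (y h)) h
  rw [hi] at this
  have h0 : ‖star y (y h) - h‖ ^ 2 ≤ 0 := by
    nlinarith [norm_nonneg (star y (y h)), norm_nonneg h]
  rw [← sub_eq_zero, ← norm_eq_zero]
  exact pow_eq_zero_iff (two_ne_zero) |>.1 (le_antisymm h0 (sq_nonneg _))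

/-- Partial isometries, in algebraic form. -/
def IsPartialIsometry (w : H →L[ℂ] H) : Prop := w * star w * w = w

namespace IsPartialIsometry

variable {w : H →L[ℂ] H}

theorem apply (hw : IsPartialIsometry w) (h : H) : w (star w (w h)) = w h :=
  DFunLike.congr_fun hw h

theorem star_mul_mul_star (hw : IsPartialIsometry w) : star w * w * star w = star w := by
  simpa [mul_assoc] using congrArg star hw

theorem star_apply (hw : IsPartialIsometry w) (h : H) : star w (w (star w h)) = star w h :=
  DFunLike.congr_fun hw.star_mul_mul_star h

theorem norm_apply_star (hw : IsPartialIsometry w) (h : H) : ‖w (star w h)‖ = ‖star w h‖ := by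
  rw [← sq_eq_sq₀ (norm_nonneg _) (norm_nonneg _), norm_sq_eq_re_inner_star_mul,
    mul_apply_eq_comp, hw.star_apply, inner_self_eq_norm_sq]

theorem norm_le_one (hw : IsPartialIsometry w) : ‖w‖ ≤ 1 := by
  have h1 : ‖star w * w‖ = ‖w‖ * ‖w‖ := CStarRing.norm_star_mul_self
  have h2 : ‖star w * w‖ = ‖star w * w‖ * ‖star w * w‖ := by
    rw [← CStarRing.norm_star_mul_self (x := star w * w)]
    congr 1
    rw [star_mul, star_star, ← mul_assoc, hw.star_mul_mul_star]
  rw [h1] at h2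
  by_contra! hlt
  have h3 : 1 < ‖w‖ * ‖w‖ := by nlinarith
  nlinarith

end IsPartialIsometry

/-- Polar decomposition inside a von Neumann algebra. -/
theorem VonNeumannAlgebra.exists_polar {M : VonNeumannAlgebra H} {y : H →L[ℂ] H} (hy : y ∈ M) :
    ∃ v ∈ M, IsPartialIsometry v ∧ v * CFC.abs y = y ∧ ∀ h, y h = 0 → v h = 0 := by
  set q := CFC.abs y with hq
  have hqs : star q = q := (CFC.abs_nonneg y).isSelfAdjoint.star_eq
  set K := q.range.topologicalClosure with hK
  have hqK : ∀ h, q h ∈ K := fun h => Submodule.le_topologicalClosure _ ⟨h, rfl⟩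
  let e : H →ₗ[ℂ] K := (q : H →ₗ[ℂ] H).codRestrict K hqK
  have he : DenseRange e := by
    intro k
    rw [Metric.mem_closure_iff]
    intro ε hε
    have hk : (k : H) ∈ closure (q.range : Set H) := k.2
    obtain ⟨_, ⟨h, rfl⟩, hb⟩ := Metric.mem_closure_iff.1 hk ε hε
    exact ⟨e h, ⟨h, rfl⟩, hb⟩
  have hn : ∀ h, ‖(y : H →ₗ[ℂ] H) h‖ ≤ 1 * ‖e h‖ := fun h => by
    rw [one_mul]; exact (norm_abs_apply y h).ge
  have : CompleteSpace K := q.range.isClosed_topologicalClosure.completeSpace_coe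
  let f : K →L[ℂ] H := (y : H →ₗ[ℂ] H).extendOfNorm e
  have hf : ∀ h, f (e h) = y h := LinearMap.extendOfNorm_eq he ⟨1, hn⟩
  have hfn : ∀ k, ‖f k‖ = ‖k‖ := fun k =>
    he.induction_on k (isClosed_eq (by fun_prop) (by fun_prop)) fun h => by
      rw [hf]; exact (norm_abs_apply y h).symm
  let v : H →L[ℂ] H := f ∘L K.orthogonalProjectionOnto
  have hvq : ∀ h, v (q h) = y h := fun h => by
    have : K.orthogonalProjectionOnto (q h) = e h :=
      K.orthogonalProjectionOnto_mem_subspace_eq_self (e h)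
    simp only [v, comp_apply, this, hf]
  have hv0 : ∀ h, y h = 0 → v h = 0 := fun h hh => by
    have hqh : q h = 0 := by rw [← norm_eq_zero, hq, norm_abs_apply, hh, norm_zero]
    have : h ∈ Kᗮ := by
      rw [hK, Submodule.orthogonal_closure]
      rintro _ ⟨g, rfl⟩
      change ⟪q g, h⟫_ℂ = 0
      rw [← hqs, ContinuousLinearMap.star_eq_adjoint, adjoint_inner_left, hqh, inner_zero_right]
    simp only [v, comp_apply,
      Submodule.orthogonalProjectionOnto_apply_of_mem_orthogonal this, map_zero]
  have hext : ∀ a b : H →L[ℂ] H, (∀ h, a (q h) = b (q h)) → (∀ h, y h = 0 → a h = b h) →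
      a = b := by
    intro a b h1 h2
    have hKab : ∀ k : K, a k = b k := fun k =>
      he.induction_on k (isClosed_eq (by fun_prop) (by fun_prop)) h1
    ext h
    obtain ⟨k, hk, g, hg, rfl⟩ := K.exists_add_mem_mem_orthogonal h
    have hqg : q g = 0 := by
      refine ext_inner_left ℂ fun z => ?_
      rw [inner_zero_right, ← hqs, ContinuousLinearMap.star_eq_adjoint, adjoint_inner_right]
      exact hg _ (hqK z)
    have : y g = 0 := by rw [← norm_eq_zero, ← norm_abs_apply, ← hq, hqg, norm_zero]
    rw [map_add, map_add, h2 g this, hKab ⟨k, hk⟩]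
  have hvn : ‖v‖ ≤ 1 := v.opNorm_le_bound zero_le_one fun h => by
    rw [one_mul]
    exact (hfn _).le.trans (K.norm_orthogonalProjectionOnto_apply_le h)
  refine ⟨v, ?_, ?_, ContinuousLinearMap.ext hvq, hv0⟩
  · refine mem_iff_forall_commutant.2 fun c hc => hext _ _ (fun h => ?_) fun h hh => ?_
    · have h1 := DFunLike.congr_fun (commute_of_mem_commutant hc (abs_mem hy)).eq h
      have h2 := DFunLike.congr_fun (commute_of_mem_commutant hc hy).eq h
      simp only [mul_apply_eq_comp] at h1 h2 ⊢
      rw [hvq, h1, hvq, h2]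
    · have h2 := DFunLike.congr_fun (commute_of_mem_commutant hc hy).eq h
      simp only [mul_apply_eq_comp] at h2 ⊢
      rw [hv0 h hh, hv0 (c h) (by rw [← h2, hh, map_zero]), map_zero]
  · refine hext _ _ (fun h => ?_) fun h hh => ?_
    · simp only [mul_apply_eq_comp]
      rw [star_apply_apply_of_norm_eq hvn]
      rw [hvq, ← norm_abs_apply]
    · simp only [mul_apply_eq_comp, hv0 h hh, map_zero]

/-- The extension relation between partial isometries: `w'` agrees with `w` on all vectors on which
`w` is norm preserving. -/
def Extends {H : Type*} [NormedAddCommGroup H] [InnerProductSpace ℂ H] (w w' : H →L[ℂ] H) : Prop := ∀ h, ‖w h‖ = ‖h‖ → w' h = w h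

theorem Extends.refl {H : Type*} [NormedAddCommGroup H] [InnerProductSpace ℂ H]
    (w : H →L[ℂ] H) : Extends w w := fun _ _ => rfl

theorem Extends.trans {H : Type*} [NormedAddCommGroup H] [InnerProductSpace ℂ H]
    {w w' w'' : H →L[ℂ] H} (h₁ : Extends w w') (h₂ : Extends w' w'') :
    Extends w w'' := fun h hh => by
  rw [h₂ h (by rw [h₁ h hh, hh]), h₁ h hh]

theorem Extends.apply_star_apply {w w' : H →L[ℂ] H} (hw : IsPartialIsometry w)
    (h₁ : Extends w w') (h : H) : w' (star w (w h)) = w h := by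
  rw [h₁ _ (hw.norm_apply_star _), hw.apply]

/-- Along an extension, the displacement of a vector is controlled by the growth of its image. -/
theorem Extends.norm_sub_sq {w w' : H →L[ℂ] H} (hw : IsPartialIsometry w)
    (hw' : IsPartialIsometry w') (h₁ : Extends w w') (h : H) :
    ‖w' h - w h‖ ^ 2 = ‖w' h‖ ^ 2 - ‖w h‖ ^ 2 := by
  have hin : RCLike.re ⟪w' h, w h⟫_ℂ = ‖w h‖ ^ 2 := by
    have hfix : star w' (w h) = star w (w h) := by
      have := star_apply_apply_of_norm_eq hw'.norm_le_one (h := star w (w h))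
        (by rw [h₁.apply_star_apply hw, ← hw.norm_apply_star, hw.apply])
      rwa [h₁.apply_star_apply hw] at this
    rw [← adjoint_inner_right, ← ContinuousLinearMap.star_eq_adjoint, hfix,
      ContinuousLinearMap.star_eq_adjoint, adjoint_inner_right, inner_self_eq_norm_sq]
  rw [_root_.norm_sub_sq (𝕜 := ℂ), hin]
  ring

theorem cauchy_map_of_norm_sub_sq_le {ι E : Type*} [Preorder ι] [IsDirectedOrder ι] [Nonempty ι]
    [NormedAddCommGroup E] {f : ι → E} {g : ι → ℝ} {l : ℝ} (hg : Tendsto g atTop (𝓝 l))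
    (hfg : ∀ i j, i ≤ j → ‖f j - f i‖ ^ 2 ≤ |g j - g i|) : Cauchy (map f atTop) := by
  refine cauchy_map_iff.2 ⟨inferInstance, ?_⟩
  have hgc := hg.cauchy_map
  rw [Metric.cauchy_iff] at hgc
  obtain ⟨_, hgc⟩ := hgc
  rw [← cauchy_map_iff']
  refine Metric.cauchy_iff.2 ⟨inferInstance, fun ε hε => ?_⟩
  obtain ⟨t, ht, hd⟩ := hgc ((ε / 2) ^ 2) (by positivity)
  obtain ⟨i, hi⟩ := mem_atTop_sets.1 (mem_map.1 ht)
  have key : ∀ j, i ≤ j → dist (f j) (f i) < ε / 2 := fun j hj => by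
    rw [dist_eq_norm]
    refine lt_of_pow_lt_pow_left₀ 2 (by positivity) ((hfg i j hj).trans_lt ?_)
    exact hd _ (hi j hj) _ (hi i le_rfl)
  refine ⟨f '' Set.Ici i, image_mem_map (Ici_mem_atTop i), ?_⟩
  rintro _ ⟨j, hj, rfl⟩ _ ⟨k, hk, rfl⟩
  calc dist (f j) (f k) ≤ dist (f j) (f i) + dist (f k) (f i) := dist_triangle_right _ _ _
    _ < ε := by linarith [key j hj, key k hk]

/-- A directed family of partial isometries in `M`, increasing for extension, has an upper bound. -/
theorem VonNeumannAlgebra.exists_extends_of_directed {M : VonNeumannAlgebra H} {ι : Type*}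
    [Preorder ι] [IsDirectedOrder ι] [Nonempty ι] {w : ι → H →L[ℂ] H} (hM : ∀ i, w i ∈ M)
    (hw : ∀ i, IsPartialIsometry (w i)) (hmono : ∀ i j, i ≤ j → Extends (w i) (w j)) :
    ∃ W ∈ M, IsPartialIsometry W ∧ ∀ i, Extends (w i) W := by
  have hle : ∀ i h, ‖w i h‖ ≤ 1 * ‖h‖ := fun i h => by
    rw [one_mul]; exact norm_apply_le_of_norm_le_one (hw i).norm_le_one h
  have hg : ∀ h, Monotone fun i => ‖w i h‖ ^ 2 := fun h i j hij => by
    have := (hmono i j hij).norm_sub_sq (hw i) (hw j) h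
    have h0 := sq_nonneg ‖w j h - w i h‖
    simp only
    linarith
  have hc : ∀ h, Cauchy (map (fun i => w i h) atTop) := fun h => by
    have hb : BddAbove (Set.range fun i => ‖w i h‖ ^ 2) := ⟨‖h‖ ^ 2, by
      rintro _ ⟨i, rfl⟩
      have := hle i h
      rw [one_mul] at this
      exact pow_le_pow_left₀ (norm_nonneg _) this 2⟩
    refine cauchy_map_of_norm_sub_sq_le (tendsto_atTop_ciSup (hg h) hb) fun i j hij => ?_
    rw [(hmono i j hij).norm_sub_sq (hw i) (hw j) h]
    exact le_abs_self _
  obtain ⟨W, hWn, hW⟩ := exists_continuousLinearMap_of_cauchy hle hc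
  have hext : ∀ i, Extends (w i) W := fun i h hh =>
    tendsto_nhds_unique (hW h) (tendsto_const_nhds.congr' <| by
      filter_upwards [Ici_mem_atTop i] with j hj
      exact (hmono i j hj h hh).symm)
  have hW1 : ‖W‖ ≤ 1 := W.opNorm_le_bound zero_le_one hWn
  refine ⟨W, mem_of_tendsto hM hW, ContinuousLinearMap.ext fun h => ?_, hext⟩
  have h1 : Tendsto (fun i => W (star W (w i h))) atTop (𝓝 ((W * star W * W) h)) :=
    ((W * star W).continuous.tendsto _).comp (hW h)
  refine tendsto_nhds_unique h1 ((hW h).congr fun i => ?_)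
  have h2 := (hext i).apply_star_apply (hw i) h
  have h3 := star_apply_apply_of_norm_eq hW1 (h := star (w i) (w i h))
    (by rw [h2, ← (hw i).norm_apply_star, (hw i).apply])
  rw [h2] at h3
  rw [h3, h2]

/-- The partial isometries in `M` extending `v`. -/
structure PartialIsometryExtension (M : VonNeumannAlgebra H) (v : H →L[ℂ] H) where
  /-- the extension -/
  val : H →L[ℂ] H
  mem : val ∈ M
  isPartialIsometry : IsPartialIsometry val
  extends_val : Extends v val

instance (M : VonNeumannAlgebra H) (v : H →L[ℂ] H) : Preorder (PartialIsometryExtension M v) where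
  le a b := Extends a.val b.val
  le_refl a := Extends.refl a.val
  le_trans _ _ _ := Extends.trans

/-- Every partial isometry in `M` extends to one whose defect projections are not linked by `M`. -/
theorem VonNeumannAlgebra.exists_extends_maximal {M : VonNeumannAlgebra H} {v : H →L[ℂ] H}
    (hvM : v ∈ M) (hv : IsPartialIsometry v) :
    ∃ w ∈ M, IsPartialIsometry w ∧ Extends v w ∧
      ∀ m ∈ M, (1 - w * star w) * m * (1 - star w * w) = 0 := by
  have : Nonempty (PartialIsometryExtension M v) := ⟨⟨v, hvM, hv, Extends.refl v⟩⟩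
  obtain ⟨⟨w, hwM, hw, hvw⟩, hmax⟩ :=
    zorn_le_nonempty (α := PartialIsometryExtension M v) fun c hc hne => by
      have := hne.to_subtype
      have : IsDirectedOrder c := ⟨fun a b => hc.directedOn.directed_val a b⟩
      obtain ⟨W, hWM, hW, hcW⟩ := exists_extends_of_directed (M := M)
        (w := fun i : c => i.1.val) (fun i => i.1.mem) (fun i => i.1.isPartialIsometry)
        fun _ _ hij => hij
      obtain ⟨i, hi⟩ := hne
      exact ⟨⟨W, hWM, hW, i.extends_val.trans (hcW ⟨i, hi⟩)⟩, fun j hj => hcW ⟨j, hj⟩⟩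
  refine ⟨w, hwM, hw, hvw, fun m hm => ?_⟩
  set y := (1 - w * star w) * m * (1 - star w * w) with hy
  have hyM : y ∈ M := mul_mem (mul_mem (sub_mem (one_mem _) (mul_mem hwM (star_mem hwM))) hm)
    (sub_mem (one_mem _) (mul_mem (star_mem hwM) hwM))
  obtain ⟨z, hzM, hz, hzy, hz0⟩ := exists_polar hyM
  have hyw : y * star w = 0 := by
    have : (1 - star w * w) * star w = 0 := by
      rw [sub_mul, one_mul, hw.star_mul_mul_star, sub_self]
    rw [hy, mul_assoc, this, mul_zero]
  have hwy : star w * y = 0 := by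
    have : star w * (1 - w * star w) = 0 := by
      rw [mul_sub, mul_one, ← mul_assoc, hw.star_mul_mul_star, sub_self]
    rw [hy, ← mul_assoc, ← mul_assoc, this, zero_mul, zero_mul]
  have hzw : z * star w = 0 := ContinuousLinearMap.ext fun h =>
    hz0 _ (DFunLike.congr_fun hyw h)
  have hwz' : w * star z = 0 := by simpa using congrArg star hzw
  have hzw' : star z * w = 0 := by
    have habs : CFC.abs y * (star z * w) = 0 := by
      have : CFC.abs y * star z = star y := by
        rw [← (CFC.abs_nonneg y).isSelfAdjoint.star_eq, ← star_mul, hzy]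
      rw [← mul_assoc, this]
      simpa using congrArg star hwy
    have : z * (star z * w) = 0 := ContinuousLinearMap.ext fun h => hz0 _ <| by
      rw [← norm_eq_zero, ← norm_abs_apply, norm_eq_zero]
      exact DFunLike.congr_fun habs h
    rw [← hz.star_mul_mul_star, mul_assoc, mul_assoc, this, mul_zero]
  have hwz : star w * z = 0 := by simpa using congrArg star hzw'
  have hsum : IsPartialIsometry (w + z) := by
    have e1 : w * star w * z = 0 := by rw [mul_assoc, hwz, mul_zero]
    have e2 : z * star z * w = 0 := by rw [mul_assoc, hzw', mul_zero]
    unfold IsPartialIsometry at hw hz ⊢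
    simp only [star_add, add_mul, mul_add, hzw, hwz', e1, e2, hw, hz, add_zero, zero_add]
  have hwsum : Extends w (w + z) := fun h hh => by
    have h1 := star_apply_apply_of_norm_eq hw.norm_le_one hh
    have h2 : z h = 0 := by
      rw [← h1]; exact DFunLike.congr_fun hzw (w h)
    simp [h2]
  have hback : Extends (w + z) w :=
    hmax (b := ⟨w + z, add_mem hwM hzM, hsum, hvw.trans hwsum⟩) hwsum
  have hz00 : z = 0 := ContinuousLinearMap.ext fun h => by
    have h1 : w (star z (z h)) = 0 := DFunLike.congr_fun hwz' (z h)
    have h2 : (w + z) (star z (z h)) = z h := by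
      rw [add_apply, h1, zero_add, hz.apply]
    have h3 := hback (star z (z h)) (by rw [h2, ← hz.norm_apply_star, hz.apply])
    rw [h1, h2] at h3
    exact h3.symm
  rw [← hzy, hz00, zero_mul]

theorem norm_sub_range_sq {y : H →L[ℂ] H} (hy : star y * y = 1) (h : H) :
    ‖h - y (star y h)‖ ^ 2 = ‖h‖ ^ 2 - ‖star y h‖ ^ 2 := by
  rw [norm_sub_sq (𝕜 := ℂ), ← adjoint_inner_left, ← ContinuousLinearMap.star_eq_adjoint,
    inner_self_eq_norm_sq, norm_apply_of_star_mul_self_eq_one hy]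
  ring

theorem star_pow_mul_pow_eq_one {y : H →L[ℂ] H} (hy : star y * y = 1) (n : ℕ) :
    star (y ^ n) * y ^ n = 1 := by
  induction n with
  | zero => simp
  | succ n ih =>
    rw [pow_succ', star_mul, mul_assoc, ← mul_assoc (star y), hy, one_mul, ih]

/-- The iterates, starting at `t`, of the map `s ↦ w + a * s * star x`. -/
noncomputable def woldSeq (a x t w : H →L[ℂ] H) : ℕ → H →L[ℂ] H
  | 0 => t
  | n + 1 => w + a * woldSeq a x t w n * star x

section Wold

variable {a x t r : H →L[ℂ] H}

theorem woldSeq_add (w : H →L[ℂ] H) (n m : ℕ) :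
    woldSeq a x t w (n + m) =
      woldSeq a x t w n + a ^ n * (woldSeq a x t w m - t) * star (x ^ n) := by
  induction n with
  | zero => simp [woldSeq]
  | succ n ih =>
    rw [show n + 1 + m = (n + m) + 1 by ring, woldSeq, woldSeq, ih, pow_succ', pow_succ' x, star_mul]
    simp only [mul_add, add_mul, mul_assoc, add_assoc]

theorem defect_mul (hx : star x * x = 1) : r * (1 - x * star x) * x = 0 := by
  rw [mul_assoc, sub_mul, mul_assoc, hx, one_mul, mul_one, sub_self, mul_zero]

theorem star_mul_defect (hx : star x * x = 1) (hr : star a * r = r * star x) :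
    star a * (r * (1 - x * star x)) = 0 := by
  rw [← mul_assoc, hr, mul_assoc, mul_sub, ← mul_assoc (star x), hx, one_mul, mul_one, sub_self,
    mul_zero]

theorem woldSeq_succ_mul (hx : star x * x = 1) (n : ℕ) :
    woldSeq a x t (r * (1 - x * star x)) (n + 1) * x =
      a * woldSeq a x t (r * (1 - x * star x)) n := by
  rw [woldSeq, add_mul, defect_mul hx, mul_assoc _ (star x), hx, mul_one, zero_add]

theorem star_mul_woldSeq_succ (hx : star x * x = 1) (ha : star a * a = 1)
    (hr : star a * r = r * star x) (n : ℕ) :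
    star a * woldSeq a x t (r * (1 - x * star x)) (n + 1) =
      woldSeq a x t (r * (1 - x * star x)) n * star x := by
  rw [woldSeq, mul_add, star_mul_defect hx hr, zero_add, ← mul_assoc, ← mul_assoc, ha, one_mul]

theorem woldSeq_mul_pow (hx : star x * x = 1) (hat : a * t = t * x) (n : ℕ) :
    woldSeq a x t (r * (1 - x * star x)) n * x ^ n = t * x ^ n := by
  induction n with
  | zero => rfl
  | succ n ih =>
    rw [pow_succ', ← mul_assoc, woldSeq_succ_mul hx, mul_assoc, ih, ← mul_assoc, hat, mul_assoc]

theorem norm_woldSeq_apply_le (hx : star x * x = 1) (ha : star a * a = 1)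
    (hr : star a * r = r * star x) (n : ℕ) (h : H) :
    ‖woldSeq a x t (r * (1 - x * star x)) n h‖ ≤ (‖r‖ + ‖t‖) * ‖h‖ := by
  induction n generalizing h with
  | zero =>
    exact (t.le_opNorm h).trans (by gcongr; linarith [norm_nonneg r])
  | succ n ih =>
    set w := r * (1 - x * star x) with hw
    have horth : RCLike.re ⟪w h, a (woldSeq a x t w n (star x h))⟫_ℂ = 0 := by
      rw [← adjoint_inner_left, ← ContinuousLinearMap.star_eq_adjoint,
        show star a (w h) = 0 from DFunLike.congr_fun (star_mul_defect hx hr) h]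
      simp
    have h1 : ‖w h‖ ≤ (‖r‖ + ‖t‖) * ‖h - x (star x h)‖ :=
      (r.le_opNorm (h - x (star x h))).trans (by gcongr; linarith [norm_nonneg t])
    have h2 := ih (star x h)
    have h3 := norm_sub_range_sq hx h
    have h4 : ‖woldSeq a x t w (n + 1) h‖ ^ 2 =
        ‖w h‖ ^ 2 + ‖woldSeq a x t w n (star x h)‖ ^ 2 := by
      change ‖w h + a (woldSeq a x t w n (star x h))‖ ^ 2 = _
      rw [norm_add_sq (𝕜 := ℂ), horth, norm_apply_of_star_mul_self_eq_one ha]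
      ring
    refine (sq_le_sq₀ (norm_nonneg _) ?_).1 ?_
    · positivity
    rw [h4]
    calc _ ≤ ((‖r‖ + ‖t‖) * ‖h - x (star x h)‖) ^ 2 + ((‖r‖ + ‖t‖) * ‖star x h‖) ^ 2 := by
          gcongr
      _ = _ := by rw [mul_pow, mul_pow, mul_pow, h3]; ring

/-- The iterates converge pointwise. -/
theorem exists_tendsto_woldSeq (hx : star x * x = 1) (ha : star a * a = 1)
    (hat : a * t = t * x) (hr : star a * r = r * star x) :
    ∃ s : H →L[ℂ] H, ∀ h,
      Tendsto (fun n => woldSeq a x t (r * (1 - x * star x)) n h) atTop (𝓝 (s h)) := by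
  set w := r * (1 - x * star x) with hw
  set C := ‖r‖ + ‖t‖ with hC
  have hC0 : 0 ≤ C := by positivity
  have hb : ∀ n h, ‖woldSeq a x t w n h‖ ≤ C * ‖h‖ := norm_woldSeq_apply_le hx ha hr
  have hdiff : ∀ m y, ‖(woldSeq a x t w m - t) y‖ ^ 2 ≤
      (2 * C) ^ 2 * (‖y‖ ^ 2 - ‖star (x ^ m) y‖ ^ 2) := fun m y => by
    have hkill : (woldSeq a x t w m - t) ((x ^ m) (star (x ^ m) y)) = 0 := by
      have : (woldSeq a x t w m - t) * x ^ m = 0 := by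
        rw [sub_mul, woldSeq_mul_pow hx hat, sub_self]
      exact DFunLike.congr_fun this _
    have h1 : (woldSeq a x t w m - t) y =
        (woldSeq a x t w m - t) (y - (x ^ m) (star (x ^ m) y)) := by
      rw [map_sub, hkill, sub_zero]
    rw [h1, ← norm_sub_range_sq (star_pow_mul_pow_eq_one hx m), ← mul_pow]
    gcongr
    generalize y - (x ^ m) (star (x ^ m) y) = z
    calc ‖woldSeq a x t w m z - t z‖ ≤ C * ‖z‖ + C * ‖z‖ :=
          (norm_sub_le _ _).trans (add_le_add (hb m z) (hb 0 z))
      _ = 2 * C * ‖z‖ := by ring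
  have hpow : ∀ n m h, star (x ^ (n + m)) h = star (x ^ m) (star (x ^ n) h) := fun n m h => by
    rw [pow_add, star_mul]; rfl
  have hanti : ∀ h, Antitone fun n => (2 * C) ^ 2 * ‖star (x ^ n) h‖ ^ 2 := fun h n k hnk => by
    obtain ⟨m, rfl⟩ := Nat.exists_eq_add_of_le hnk
    have h1 := norm_sub_range_sq (star_pow_mul_pow_eq_one hx m) (star (x ^ n) h)
    simp only [hpow]
    gcongr ?_ * ?_
    nlinarith [sq_nonneg ‖star (x ^ n) h - (x ^ m) (star (x ^ m) (star (x ^ n) h))‖]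
  have hcauchy : ∀ h, Cauchy (map (fun n => woldSeq a x t w n h) atTop) := fun h => by
    have hbdd : BddBelow (Set.range fun n => (2 * C) ^ 2 * ‖star (x ^ n) h‖ ^ 2) :=
      ⟨0, by rintro _ ⟨n, rfl⟩; positivity⟩
    refine cauchy_map_of_norm_sub_sq_le (tendsto_atTop_ciInf (hanti h) hbdd) fun n k hnk => ?_
    obtain ⟨m, rfl⟩ := Nat.exists_eq_add_of_le hnk
    have h1 : woldSeq a x t w (n + m) h - woldSeq a x t w n h =
        (a ^ n) ((woldSeq a x t w m - t) (star (x ^ n) h)) := by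
      rw [woldSeq_add]
      simp only [add_apply, mul_apply_eq_comp, add_sub_cancel_left]
    rw [h1, norm_apply_of_star_mul_self_eq_one (star_pow_mul_pow_eq_one ha n)]
    refine (hdiff m _).trans ?_
    rw [abs_sub_comm, hpow, ← mul_sub]
    exact le_abs_self _
  obtain ⟨s, -, hs⟩ := exists_continuousLinearMap_of_cauchy hb hcauchy
  exact ⟨s, hs⟩

theorem woldSeq_mul_woldSeq {t' r' : H →L[ℂ] H} (hx : star x * x = 1) (ha : star a * a = 1)
    (hr : star a * r = r * star x) (htt : t' * t = 1) (hrr : r' * r = 1) (n : ℕ) :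
    woldSeq x a t' (r' * (1 - a * star a)) n * woldSeq a x t (r * (1 - x * star x)) n = 1 := by
  induction n with
  | zero => exact htt
  | succ n ih =>
    have h1 := defect_mul (r := r') ha
    have h2 := star_mul_defect hx hr
    have h3 : r' * (1 - a * star a) * (r * (1 - x * star x)) = 1 - x * star x := by
      rw [mul_assoc r', sub_mul, mul_assoc a, h2, mul_zero, sub_zero, one_mul, ← mul_assoc, hrr,
        one_mul]
    rw [woldSeq, woldSeq, add_mul, mul_add, mul_add, h3]
    generalize woldSeq x a t' (r' * (1 - a * star a)) n = p at ih ⊢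
    generalize woldSeq a x t (r * (1 - x * star x)) n = q at ih ⊢
    have e1 : r' * (1 - a * star a) * (a * q * star x) = 0 := by
      rw [mul_assoc a, ← mul_assoc, h1, zero_mul]
    have e2 : x * p * star a * (r * (1 - x * star x)) = 0 := by
      rw [mul_assoc, h2, mul_zero]
    have e3 : x * p * star a * (a * q * star x) = x * star x := by
      calc _ = x * (p * ((star a * a) * q)) * star x := by noncomm_ring
        _ = _ := by rw [ha, one_mul, ih, mul_one]
    rw [e1, e2, e3]
    abel

end Wold

theorem mul_eq_one_of_tendsto {H : Type*} [NormedAddCommGroup H] [InnerProductSpace ℂ H]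
    {p q : ℕ → H →L[ℂ] H} {P Q : H →L[ℂ] H} {C : ℝ}
    (hC : ∀ n h, ‖p n h‖ ≤ C * ‖h‖)
    (hp : ∀ h, Tendsto (fun n => p n h) atTop (𝓝 (P h)))
    (hq : ∀ h, Tendsto (fun n => q n h) atTop (𝓝 (Q h))) (hpq : ∀ n, p n * q n = 1) :
    P * Q = 1 := by
  ext h
  have h1 : Tendsto (fun n => p n (Q h - q n h)) atTop (𝓝 0) := by
    refine squeeze_zero_norm (fun n => hC n _) ?_
    have : Tendsto (fun n => Q h - q n h) atTop (𝓝 (Q h - Q h)) := (hq h).const_sub _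
    rw [sub_self] at this
    simpa using this.norm.const_mul C
  have h2 : Tendsto (fun n => p n (Q h) - h) atTop (𝓝 0) := h1.congr fun n => by
    rw [map_sub, show p n (q n h) = h from DFunLike.congr_fun (hpq n) h]
  exact tendsto_nhds_unique (hp (Q h)) (by simpa using h2.add_const h)

/-- Similar isometries of a von Neumann algebra are unitarily equivalent in it. -/
theorem VonNeumannAlgebra.exists_unitary_of_similar {M : VonNeumannAlgebra H}
    {a x t t' : H →L[ℂ] H} (hxM : x ∈ M) (haM : a ∈ M) (htM : t ∈ M) (htM' : t' ∈ M)
    (hx : star x * x = 1) (ha : star a * a = 1) (htt : t * t' = 1) (htt' : t' * t = 1)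
    (hat : a * t = t * x) :
    ∃ v ∈ M, star v * v = 1 ∧ v * star v = 1 ∧ a * v = v * x := by
  have hxt : x * t' = t' * a := by
    calc x * t' = t' * (t * x) * t' := by rw [← mul_assoc, htt', one_mul]
      _ = t' * a * (t * t') := by rw [← hat]; noncomm_ring
      _ = t' * a := by rw [htt, mul_one]
  have hr : star a * star t' = star t' * star x := by rw [← star_mul, ← hxt, star_mul]
  have hr' : star x * star t = star t * star a := by rw [← star_mul, ← hat, star_mul]
  have hrr : star t * star t' = 1 := by rw [← star_mul, htt', star_one]
  have hrr' : star t' * star t = 1 := by rw [← star_mul, htt, star_one]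
  obtain ⟨s, hs⟩ := exists_tendsto_woldSeq hx ha hat hr
  obtain ⟨s', hs'⟩ := exists_tendsto_woldSeq ha hx hxt hr'
  have hseqM : ∀ n, woldSeq a x t (star t' * (1 - x * star x)) n ∈ M := fun n => by
    induction n with
    | zero => exact htM
    | succ n ih =>
      exact add_mem (mul_mem (star_mem htM') (sub_mem (one_mem _) (mul_mem hxM (star_mem hxM))))
        (mul_mem (mul_mem haM ih) (star_mem hxM))
  have hsM : s ∈ M := mem_of_tendsto hseqM hs
  have hss : s * s' = 1 := mul_eq_one_of_tendsto (norm_woldSeq_apply_le hx ha hr) hs hs'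
    (woldSeq_mul_woldSeq ha hx hr' htt hrr')
  have hss' : s' * s = 1 := mul_eq_one_of_tendsto (norm_woldSeq_apply_le ha hx hr') hs' hs
    (woldSeq_mul_woldSeq hx ha hr htt' hrr)
  have hsx : s * x = a * s := ContinuousLinearMap.ext fun h => by
    refine tendsto_nhds_unique ((tendsto_add_atTop_iff_nat 1).2 (hs (x h)))
      (((a.continuous.tendsto _).comp (hs h)).congr fun n => ?_)
    exact (DFunLike.congr_fun (woldSeq_succ_mul hx n) h).symm
  have has : star a * s = s * star x := ContinuousLinearMap.ext fun h => by
    refine tendsto_nhds_unique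
      (((star a).continuous.tendsto _).comp ((tendsto_add_atTop_iff_nat 1).2 (hs h)))
      ((hs (star x h)).congr fun n => ?_)
    exact (DFunLike.congr_fun (star_mul_woldSeq_succ hx ha hr n) h).symm
  have hcomm : Commute (star s * s) x := by
    have h1 : star s * a = x * star s := by simpa using congrArg star has
    change star s * s * x = x * (star s * s)
    rw [mul_assoc, hsx, ← mul_assoc, h1, mul_assoc]
  have hq : Commute (CFC.abs s) x := hcomm.cfcₙ_nnreal NNReal.sqrt
  obtain ⟨v, hvM, hv, hvs, -⟩ := exists_polar hsM
  have hvu : v * (CFC.abs s * s') = 1 := by rw [← mul_assoc, hvs, hss]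
  have hvv : v * star v = 1 := by
    calc v * star v = v * star v * (v * (CFC.abs s * s')) := by rw [hvu, mul_one]
      _ = (v * star v * v) * (CFC.abs s * s') := by noncomm_ring
      _ = 1 := by rw [hv, hvu]
  have hqs : star (CFC.abs s) = CFC.abs s := (CFC.abs_nonneg s).isSelfAdjoint.star_eq
  set k := CFC.abs s * (s' * star s') with hk
  have hqk : CFC.abs s * k = 1 := by
    calc CFC.abs s * k = CFC.abs s * CFC.abs s * (s' * star s') := by rw [hk, mul_assoc]
      _ = star s * (s * s') * star s' := by rw [CFC.abs_mul_abs]; noncomm_ring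
      _ = 1 := by rw [hss, mul_one, ← star_mul, hss', star_one]
  have hkq : star k * CFC.abs s = 1 := by simpa [hqs] using congrArg star hqk
  have hvk : v = s * k := by rw [← hvs, mul_assoc, hqk, mul_one]
  have hvv' : star v * v = 1 := by
    calc star v * v = star k * (star s * s) * k := by rw [hvk, star_mul]; noncomm_ring
      _ = (star k * CFC.abs s) * (CFC.abs s * k) := by rw [← CFC.abs_mul_abs]; noncomm_ring
      _ = 1 := by rw [hkq, hqk, one_mul]
  refine ⟨v, hvM, hvv', hvv, ?_⟩
  have hkey : a * v * CFC.abs s = v * x * CFC.abs s := by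
    rw [mul_assoc, hvs, ← hsx, mul_assoc, ← hq.eq, ← mul_assoc, hvs]
  calc a * v = a * v * CFC.abs s * k := by rw [mul_assoc (a * v), hqk, mul_one]
    _ = v * x := by rw [hkey, mul_assoc (v * x), hqk, mul_one]

/-- In a C*-convex combination of contractions equal to an isometry, every component is an isometry
intertwined with it by the corresponding coefficient. -/
theorem isometry_component {k : ℕ} {a t : Fin k → H →L[ℂ] H} {x : H →L[ℂ] H}
    (hx : star x * x = 1) (ha : ∀ i, ‖a i‖ ≤ 1) (ht : ∀ i, ∃ s, t i * s = 1)
    (hsum : ∑ i, star (t i) * t i = 1) (hxa : x = ∑ i, star (t i) * a i * t i) (i : Fin k) :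
    star (a i) * a i = 1 ∧ a i * t i = t i * x := by
  have hnx := norm_apply_of_star_mul_self_eq_one hx
  have hT : ∀ h, ∑ i, ‖t i h‖ ^ 2 = ‖h‖ ^ 2 := fun h => by
    simp_rw [norm_sq_eq_re_inner_star_mul]
    rw [← map_sum, ← inner_sum, ← sum_apply, hsum, one_apply_eq_self, inner_self_eq_norm_sq]
  have hI : ∀ h, ∑ i, RCLike.re ⟪t i (x h), a i (t i h)⟫_ℂ = ‖h‖ ^ 2 := fun h => by
    have h1 : ∀ i, ⟪t i (x h), a i (t i h)⟫_ℂ = ⟪x h, (star (t i) * a i * t i) h⟫_ℂ := fun i => by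
      rw [← adjoint_inner_right]; rfl
    simp_rw [h1]
    rw [← map_sum, ← inner_sum, ← sum_apply, ← hxa, inner_self_eq_norm_sq, hnx]
  have hle : ∀ h i, ‖a i (t i h)‖ ^ 2 ≤ ‖t i h‖ ^ 2 := fun h i =>
    pow_le_pow_left₀ (norm_nonneg _) (norm_apply_le_of_norm_le_one (ha i) _) 2
  have hzero : ∀ h, ∑ i, (‖t i (x h) - a i (t i h)‖ ^ 2 +
      (‖t i h‖ ^ 2 - ‖a i (t i h)‖ ^ 2)) = 0 := fun h => by
    have h1 : ∀ i, ‖t i (x h) - a i (t i h)‖ ^ 2 + (‖t i h‖ ^ 2 - ‖a i (t i h)‖ ^ 2) =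
        ‖t i (x h)‖ ^ 2 + ‖t i h‖ ^ 2 - 2 * RCLike.re ⟪t i (x h), a i (t i h)⟫_ℂ := fun i => by
      rw [norm_sub_sq (𝕜 := ℂ)]; ring
    simp_rw [h1]
    rw [Finset.sum_sub_distrib, Finset.sum_add_distrib, hT, hT, ← Finset.mul_sum, hI, hnx]
    ring
  have hterm : ∀ h, ‖t i (x h) - a i (t i h)‖ ^ 2 + (‖t i h‖ ^ 2 - ‖a i (t i h)‖ ^ 2) = 0 :=
    fun h => (Finset.sum_eq_zero_iff_of_nonneg fun j _ =>
      add_nonneg (sq_nonneg _) (sub_nonneg.2 (hle h j))).1 (hzero h) i (Finset.mem_univ i)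
  have hat : a i * t i = t i * x := ContinuousLinearMap.ext fun h => by
    have h1 : ‖t i (x h) - a i (t i h)‖ ^ 2 = 0 := by
      linarith [hterm h, hle h i, sq_nonneg ‖t i (x h) - a i (t i h)‖]
    have h2 := norm_eq_zero.1 (pow_eq_zero_iff two_ne_zero |>.1 h1)
    exact (sub_eq_zero.1 h2).symm
  refine ⟨star_mul_self_eq_one_of_norm_eq fun h => ?_, hat⟩
  obtain ⟨s, hs⟩ := ht i
  have hsh : t i (s h) = h := DFunLike.congr_fun hs h
  have h1 := hterm (s h)
  rw [hsh] at h1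
  have h2 := hle (s h) i
  rw [hsh] at h2
  exact (sq_eq_sq₀ (norm_nonneg _) (norm_nonneg _)).1
    (by linarith [sq_nonneg ‖t i (x (s h)) - a i h‖])

/-- The components of a C*-convex combination equal to an isometry are unitarily equivalent
to it. -/
theorem VonNeumannAlgebra.exists_unitary_component {M : VonNeumannAlgebra H} {k : ℕ}
    {a t : Fin k → H →L[ℂ] H} {x : H →L[ℂ] H} (hxM : x ∈ M) (hx : star x * x = 1)
    (haM : ∀ i, a i ∈ M) (ha : ∀ i, ‖a i‖ ≤ 1) (htM : ∀ i, t i ∈ M)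
    (ht : ∀ i, ∃ s ∈ M, t i * s = 1 ∧ s * t i = 1)
    (hsum : ∑ i, star (t i) * t i = 1) (hxa : x = ∑ i, star (t i) * a i * t i) (i : Fin k) :
    ∃ u ∈ M, star u * u = 1 ∧ u * star u = 1 ∧ a i = star u * x * u := by
  obtain ⟨hai, hat⟩ := isometry_component hx ha (fun i => (ht i).imp fun s hs => hs.2.1) hsum hxa i
  obtain ⟨s, hsM, hts, hst⟩ := ht i
  obtain ⟨v, hvM, hv, hv', hav⟩ :=
    exists_unitary_of_similar hxM (haM i) (htM i) hsM hx hai hts hst hat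
  refine ⟨star v, star_mem hvM, by rwa [star_star], by rwa [star_star], ?_⟩
  rw [star_star, ← hav, mul_assoc, hv', mul_one]

/-- Replacing `y` by the identity on the complement of a projection commuting with it keeps it
a contraction. -/
theorem norm_mul_add_one_sub_le_one {c y : H →L[ℂ] H} (hc : IsStarProjection c)
    (hcy : Commute c y) (hy : ‖y‖ ≤ 1) : ‖y * c + (1 - c)‖ ≤ 1 := by
  have hcc : c * c = c := hc.isIdempotentElem
  have hcs : star c = c := hc.isSelfAdjoint
  refine opNorm_le_bound _ zero_le_one fun h => ?_
  rw [one_mul]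
  have hcs' : ∀ g g' : H, ⟪c g, g'⟫_ℂ = ⟪g, c g'⟫_ℂ := fun g g' => by
    conv_lhs => rw [← hcs, ContinuousLinearMap.star_eq_adjoint, adjoint_inner_left]
  have hcc' : ∀ g, c (c g) = c g := fun g => DFunLike.congr_fun hcc g
  have hyc : y (c h) = c (y (c h)) := by
    have h1 : c (y (c h)) = y (c (c h)) := DFunLike.congr_fun hcy (c h)
    rw [h1, hcc']
  have horth : ∀ g : H, ⟪c g, h - c h⟫_ℂ = 0 := fun g => by
    rw [hcs', map_sub, hcc', sub_self, inner_zero_right]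
  have h1 : ‖(y * c + (1 - c)) h‖ ^ 2 = ‖y (c h)‖ ^ 2 + ‖h - c h‖ ^ 2 := by
    change ‖y (c h) + (h - c h)‖ ^ 2 = _
    rw [norm_add_sq (𝕜 := ℂ), hyc, horth]
    simp
  have h2 : ‖h‖ ^ 2 = ‖c h‖ ^ 2 + ‖h - c h‖ ^ 2 := by
    conv_lhs => rw [← add_sub_cancel (c h) h, norm_add_sq (𝕜 := ℂ), horth]
    simp
  refine (sq_le_sq₀ (norm_nonneg _) (norm_nonneg _)).1 ?_
  rw [h1, h2]
  gcongr
  exact norm_apply_le_of_norm_le_one hy _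

/-- If `x` is isometric on the range of a central projection `c`, then on that range the components
of a C*-convex combination equal to `x` are unitarily equivalent to it. -/
theorem VonNeumannAlgebra.exists_unitary_component_mul {M : VonNeumannAlgebra H} {k : ℕ}
    {a t : Fin k → H →L[ℂ] H} {x c : H →L[ℂ] H} (hc : IsStarProjection c) (hcM : c ∈ M)
    (hcM' : c ∈ M.commutant) (hxM : x ∈ M) (hx : star x * x * c = c)
    (haM : ∀ i, a i ∈ M) (ha : ∀ i, ‖a i‖ ≤ 1) (htM : ∀ i, t i ∈ M)
    (ht : ∀ i, ∃ s ∈ M, t i * s = 1 ∧ s * t i = 1)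
    (hsum : ∑ i, star (t i) * t i = 1) (hxa : x = ∑ i, star (t i) * a i * t i) (i : Fin k) :
    ∃ u ∈ M, star u * u = 1 ∧ u * star u = 1 ∧ a i * c = star u * x * u * c := by
  have hcc : c * c = c := hc.isIdempotentElem
  have hcs : star c = c := hc.isSelfAdjoint
  have hcm : ∀ {m}, m ∈ M → c * m = m * c := fun hm => commute_of_mem_commutant hcM' hm
  have hcutM : ∀ {m}, m ∈ M → m * c + (1 - c) ∈ M := fun hm =>
    add_mem (mul_mem hm hcM) (sub_mem (one_mem _) hcM)
  have hcut : ∀ m : H →L[ℂ] H, (m * c + (1 - c)) * c = m * c := fun m => by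
    rw [add_mul, sub_mul, one_mul, mul_assoc, hcc, sub_self, add_zero]
  have hx' : star (x * c + (1 - c)) * (x * c + (1 - c)) = 1 := by
    have h1 : star (x * c + (1 - c)) = star x * c + (1 - c) := by
      rw [star_add, star_mul, star_sub, star_one, hcs, hcm (star_mem hxM)]
    have h2 : c * (x * c + (1 - c)) = x * c := by rw [hcm (hcutM hxM), hcut]
    have h3 : (1 - c) * (x * c + (1 - c)) = 1 - c := by
      rw [sub_mul, one_mul, h2, add_sub_cancel_left]
    rw [h1, add_mul, mul_assoc, h2, h3, ← mul_assoc, hx, add_sub_cancel]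
  have hxa' : x * c + (1 - c) = ∑ i, star (t i) * (a i * c + (1 - c)) * t i := by
    have h1 : ∀ i, star (t i) * (a i * c + (1 - c)) * t i =
        star (t i) * a i * t i * c + star (t i) * t i * (1 - c) := fun i => by
      have h2 : (1 - c) * t i = t i * (1 - c) := by
        rw [sub_mul, mul_sub, one_mul, mul_one, hcm (htM i)]
      rw [mul_add, add_mul, mul_assoc _ (1 - c), h2, ← mul_assoc (star (t i)), mul_assoc _ c,
        hcm (htM i)]
      simp only [mul_assoc]
    simp_rw [h1]
    rw [Finset.sum_add_distrib, ← Finset.sum_mul, ← Finset.sum_mul, ← hxa, hsum, one_mul]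
  obtain ⟨u, huM, hu, hu', hau⟩ := exists_unitary_component (hcutM hxM) hx'
    (a := fun i => a i * c + (1 - c)) (fun i => hcutM (haM i))
    (fun i => norm_mul_add_one_sub_le_one hc (hcm (haM i)) (ha i)) htM ht hsum hxa' i
  refine ⟨u, huM, hu, hu', ?_⟩
  rw [← hcut (a i), hau, mul_assoc _ u c, ← hcm huM, ← mul_assoc, mul_assoc (star u), hcut,
    mul_assoc _ u c, ← hcm huM]
  simp only [mul_assoc]

/-- If `e` and `f` in `M` satisfy `f * m * e = 0` for all `m` in `M`, then a central projection
separates them. -/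
theorem VonNeumannAlgebra.exists_central_projection {M : VonNeumannAlgebra H} {e f : H →L[ℂ] H}
    (he : e ∈ M) (hef : ∀ m ∈ M, f * m * e = 0) :
    ∃ z ∈ M, z ∈ M.commutant ∧ IsStarProjection z ∧ z * e = e ∧ f * z = 0 := by
  let S : Submodule ℂ H := Submodule.span ℂ {h | ∃ m ∈ M, ∃ g, h = m (e g)}
  let K := S.topologicalClosure
  have hSK : S ≤ K := S.le_topologicalClosure
  have : CompleteSpace K := S.isClosed_topologicalClosure.completeSpace_coe
  have hinv : ∀ b : H →L[ℂ] H, (∀ m ∈ M, ∀ g, b (m (e g)) ∈ S) → ∀ h ∈ K, b h ∈ K := by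
    intro b hb h hh
    have hS : ∀ h ∈ S, b h ∈ S := fun h hh => by
      have : S ≤ S.comap (b : H →ₗ[ℂ] H) := Submodule.span_le.2 <| by
        rintro _ ⟨m, hm, g, rfl⟩
        exact hb m hm g
      exact this hh
    exact map_mem_closure b.continuous hh hS
  have hz := isStarProjection_starProjection (U := K)
  have hrange : K.starProjection.range = K := Submodule.range_starProjection K
  refine ⟨K.starProjection, ?_, ?_, hz, ?_, ?_⟩
  · rw [IsStarProjection.mem_iff hz, hrange]
    intro c hc
    refine hinv c fun m hm g => Submodule.subset_span ⟨m, hm, c g, ?_⟩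
    have h1 : c ((m * e) g) = (m * e) (c g) :=
      DFunLike.congr_fun (commute_of_mem_commutant hc (mul_mem hm he)) g
    exact h1
  · rw [IsStarProjection.mem_iff hz, hrange, commutant_commutant]
    intro n hn
    exact hinv n fun m hm g => Submodule.subset_span ⟨n * m, mul_mem hn hm, g, rfl⟩
  · ext h
    exact Submodule.starProjection_eq_self_iff.2
      (hSK (Submodule.subset_span ⟨1, one_mem _, h, rfl⟩))
  · ext h
    have hfS : S ≤ f.ker := Submodule.span_le.2 <| by
      rintro _ ⟨m, hm, g, rfl⟩
      exact DFunLike.congr_fun (hef m hm) g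
    have hfK : K ≤ f.ker := S.topologicalClosure_minimal hfS f.isClosed_ker
    exact hfK (Submodule.starProjection_apply_mem K h)

/-- A partial isometry in `M` whose defect projections are not linked by `M` is a C*-extreme point
of the unit ball. -/
theorem isCStarExtremePoint_of_defect {M : VonNeumannAlgebra H} {x : H →L[ℂ] H} (hxM : x ∈ M)
    (hx : IsPartialIsometry x) (hdef : ∀ m ∈ M, (1 - x * star x) * m * (1 - star x * x) = 0) :
    IsCStarExtremePoint M x := by
  refine ⟨hxM, hx.norm_le_one, fun k a t haM ha htM ht hsum hxa i => ?_⟩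
  obtain ⟨z, hzM, hzM', hz, hze, hfz⟩ := VonNeumannAlgebra.exists_central_projection
    (sub_mem (one_mem M) (mul_mem (star_mem hxM) hxM)) hdef
  have hzm : ∀ {m}, m ∈ M → z * m = m * z := fun hm =>
    VonNeumannAlgebra.commute_of_mem_commutant hzM' hm
  have hzz : z * z = z := hz.isIdempotentElem
  have hzs : star z = z := hz.isSelfAdjoint
  have hiso : star x * x * (1 - z) = 1 - z := by
    have h1 : (1 - star x * x) * (1 - z) = 0 := by
      rw [mul_sub, mul_one, ← hzm (sub_mem (one_mem M) (mul_mem (star_mem hxM) hxM)), hze, sub_self]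
    rw [sub_mul, one_mul, sub_eq_zero] at h1
    exact h1.symm
  have hcoiso : star (star x) * star x * z = z := by
    rw [sub_mul, one_mul, sub_eq_zero] at hfz
    rw [star_star]
    exact hfz.symm
  obtain ⟨u, huM, hu, hu', hau⟩ := VonNeumannAlgebra.exists_unitary_component_mul
    hz.one_sub (sub_mem (one_mem M) hzM) (sub_mem (one_mem _) hzM') hxM hiso haM ha htM ht hsum
    hxa i
  obtain ⟨v, hvM, hv, hv', hav⟩ := VonNeumannAlgebra.exists_unitary_component_mul
    hz hzM hzM' (star_mem hxM) hcoiso (a := fun i => star (a i)) (fun i => star_mem (haM i))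
    (fun i => by simpa using ha i) htM ht hsum
    (by rw [hxa, star_sum]; simp [mul_assoc]) i
  have hav' : a i * z = star v * x * v * z := by
    have h1 := congrArg star hav
    simp only [star_mul, star_star, hzs] at h1
    rw [hzm (haM i), ← mul_assoc (star v), hzm (mul_mem (mul_mem (star_mem hvM) hxM) hvM)] at h1
    exact h1
  set y := u * (1 - z) + v * z with hy
  have hyz : y * z = v * z := by
    rw [hy, add_mul, mul_assoc, mul_assoc, sub_mul, one_mul, hzz, sub_self, mul_zero, zero_add]
  have hyz' : y * (1 - z) = u * (1 - z) := by
    rw [mul_sub, mul_one, hyz, hy, add_sub_cancel_right]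
  have hyM : y ∈ M := add_mem (mul_mem huM (sub_mem (one_mem M) hzM)) (mul_mem hvM hzM)
  -- an identity in `M` may be checked on both central summands
  have hsplit : ∀ p q : H →L[ℂ] H, p * z = q * z → p * (1 - z) = q * (1 - z) → p = q := by
    intro p q h1 h2
    rw [mul_sub, mul_sub, h1, mul_one, mul_one] at h2
    exact sub_left_injective h2
  have hstar : ∀ {p q c : H →L[ℂ] H}, star c = c → (∀ {m}, m ∈ M → c * m = m * c) → p ∈ M → q ∈ M →
      p * c = q * c → star p * c = star q * c := by
    intro p q c hcs hcm hp hq h1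
    have := congrArg star h1
    rwa [star_mul, star_mul, hcs, hcm (star_mem hp), hcm (star_mem hq)] at this
  have hzm' : ∀ {m}, m ∈ M → (1 - z) * m = m * (1 - z) := fun hm => by
    rw [sub_mul, mul_sub, one_mul, mul_one, hzm hm]
  have hmul : ∀ {p q p' q' c : H →L[ℂ] H}, (∀ {m}, m ∈ M → c * m = m * c) → q ∈ M → p' ∈ M →
      q' ∈ M → p * c = p' * c → q * c = q' * c → p * q * c = p' * q' * c := by
    intro p q p' q' c hcm hq hp' hq' h1 h2
    rw [mul_assoc, ← hcm hq, ← mul_assoc, h1, mul_assoc, hcm hq, h2, ← mul_assoc]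
  have hys := hstar hzs hzm hyM hvM hyz
  have hys' := hstar (by simp [hzs]) hzm' hyM huM hyz'
  refine ⟨y, hyM, hsplit _ _ ?_ ?_, hsplit _ _ ?_ ?_, hsplit _ _ ?_ ?_⟩
  · rw [hmul hzm hyM (star_mem hvM) hvM hys hyz, hv]
  · rw [hmul hzm' hyM (star_mem huM) huM hys' hyz', hu]
  · rw [hmul hzm (star_mem hyM) hvM (star_mem hvM) hyz hys, hv']
  · rw [hmul hzm' (star_mem hyM) huM (star_mem huM) hyz' hys', hu']
  · rw [hav']
    exact (hmul hzm hyM (mul_mem (star_mem hvM) hxM) hvM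
      (hmul hzm hxM (star_mem hvM) hxM hys rfl) hyz).symm
  · rw [hau]
    exact (hmul hzm' hyM (mul_mem (star_mem huM) hxM) huM
      (hmul hzm' hxM (star_mem huM) hxM hys' rfl) hyz').symm

/-- Multiplication by a unitary of `M` preserves the defect condition. -/
theorem isCStarExtremePoint_mul_unitary {M : VonNeumannAlgebra H} {w u : H →L[ℂ] H} (hwM : w ∈ M)
    (hw : IsPartialIsometry w) (hdef : ∀ m ∈ M, (1 - w * star w) * m * (1 - star w * w) = 0)
    (huM : u ∈ M) (hu : star u * u = 1) (hu' : u * star u = 1) :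
    IsCStarExtremePoint M (w * u) := by
  have h1 : w * u * star (w * u) = w * star w := by
    rw [star_mul, mul_assoc, ← mul_assoc u, hu', one_mul]
  have h2 : 1 - star (w * u) * (w * u) = star u * (1 - star w * w) * u := by
    rw [mul_sub, sub_mul, mul_one, hu, star_mul]
    simp only [mul_assoc]
  refine isCStarExtremePoint_of_defect (mul_mem hwM huM) ?_ fun m hm => ?_
  · unfold IsPartialIsometry at hw ⊢
    rw [h1, ← mul_assoc, hw]
  · rw [h1, h2, ← mul_assoc, ← mul_assoc, mul_assoc _ m, hdef _ (mul_mem hm (star_mem huM)),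
      zero_mul]

end

/-- Every contraction in a von Neumann algebra `M` is the average of two C*-extreme
points of the closed unit ball of `M`. -/
theorem contraction_average_cstarExtreme {H : Type*} [NormedAddCommGroup H]
    [InnerProductSpace ℂ H] [CompleteSpace H] (M : VonNeumannAlgebra H)
    (x : H →L[ℂ] H) (hxM : x ∈ M) (hx : ‖x‖ ≤ 1) :
    ∃ x₁ x₂ : H →L[ℂ] H, IsCStarExtremePoint M x₁ ∧ IsCStarExtremePoint M x₂ ∧
      x = (2⁻¹ : ℝ) • (x₁ + x₂) := by
  obtain ⟨v, hvM, hv, hvx, -⟩ := VonNeumannAlgebra.exists_polar hxM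
  obtain ⟨w, hwM, hw, hvw, hdef⟩ := VonNeumannAlgebra.exists_extends_maximal hvM hv
  have hwx : w * CFC.abs x = x := by
    refine ContinuousLinearMap.ext fun h => ?_
    have h1 : v (CFC.abs x h) = x h := DFunLike.congr_fun hvx h
    exact (hvw (CFC.abs x h) (by rw [h1, norm_abs_apply])).trans h1
  let q : selfAdjoint (H →L[ℂ] H) := ⟨CFC.abs x, (CFC.abs_nonneg x).isSelfAdjoint⟩
  have hq : ‖q‖ ≤ 1 := (CFC.norm_abs (a := x)).trans_le hx
  set u : H →L[ℂ] H := (selfAdjoint.unitarySelfAddISMul q hq : H →L[ℂ] H) with hu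
  have huq : u = CFC.abs x + Complex.I • CFC.sqrt (1 - CFC.abs x ^ 2) := rfl
  have hsu : star u = CFC.abs x - Complex.I • CFC.sqrt (1 - CFC.abs x ^ 2) :=
    selfAdjoint.star_coe_unitarySelfAddISMul q hq
  have hqM := VonNeumannAlgebra.abs_mem hxM
  have huM : u ∈ M := by
    rw [huq]
    exact add_mem hqM (VonNeumannAlgebra.smul_mem _
      (VonNeumannAlgebra.sqrt_mem (sub_mem (one_mem M) (pow_mem hqM 2))))
  have hu1 : star u * u = 1 := Unitary.coe_star_mul_self (selfAdjoint.unitarySelfAddISMul q hq)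
  have hu2 : u * star u = 1 := Unitary.coe_mul_star_self (selfAdjoint.unitarySelfAddISMul q hq)
  refine ⟨w * u, w * star u, isCStarExtremePoint_mul_unitary hwM hw hdef huM hu1 hu2,
    isCStarExtremePoint_mul_unitary hwM hw hdef (star_mem huM) (by rwa [star_star])
      (by rwa [star_star]), ?_⟩
  have hsum : u + star u = (2 : ℝ) • CFC.abs x := by
    rw [hsu, huq, two_smul]
    abel
  rw [← mul_add, hsum, mul_smul_comm, hwx, smul_smul]
  norm_num
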